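/- Let L, L_r, L_s, Σ, R, Q be a normed continuous-time Markov game structure, fix t ∈ ℝ, ε > 0, an integer k ≥ 1, and c ≥ 0. Let f : L → ℝ → ℝ solve the Bellman equations on [t−ε, t] with some terminal value. Let q : L → ℝ → ℝ satisfy ‖q(·, t−τ) − f(·, t−τ)‖ ≤ c·τ^{k+1} for every τ ∈ [0, ε], and let p : L → ℝ → ℝ satisfy p(l,t) = f(l,t) for all l and, for every l ∈ L and τ ∈ [t−ε,t], the derivative of p(l,·) at τ equals −opt_l over a ∈ Σ(l) of Σ_{l'} R(l,a,l')·(q(l',τ) − q(l,τ)). Then ‖p(·, t−τ) − f(·, t−τ)‖ ≤ (2c/(k+2))·τ^{k+2} for every τ ∈ [0, ε]. In particular, if the ε-net approximation of level k has step error at most c·ε^{k+1}, the ε-net approximation of level k+1 has step error at most (2c/(k+2))·ε^{k+2}. -/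

import Mathlib

/-- A normed continuous-time Markov game structure: a finite nonempty set `L` of
locations partitioned into reachability locations (`isReach l = true`) and safety
locations (`isReach l = false`), a finite set `A` of actions with a nonempty set
`enabled l` of enabled actions at each location, and a rate matrix `R` whose rows
(for enabled actions) are probability distributions on `L`. -/
structure NCTMG (L A : Type) [Fintype L] [DecidableEq L] [Fintype A] where
  isReach : L → Bool
  enabled : L → Finset A
  enabled_nonempty : ∀ l, (enabled l).Nonempty
  R : L → A → L → ℝ
  R_nonneg : ∀ l a l', a ∈ enabled l → 0 ≤ R l a l'
  R_sum : ∀ l a, a ∈ enabled l → (∑ l', R l a l') = 1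

namespace NCTMG

variable {L A : Type} [Fintype L] [DecidableEq L] [Fintype A]

/-- The generator `Q(l,a,l') = R(l,a,l') − δ_{l,l'}`. -/
def Q (M : NCTMG L A) (l : L) (a : A) (l' : L) : ℝ :=
  M.R l a l' - (if l = l' then 1 else 0)

/-- `opt_l`: maximum over enabled actions at reachability locations, minimum
over enabled actions at safety locations. -/
noncomputable def opt (M : NCTMG L A) (l : L) (v : A → ℝ) : ℝ :=
  if M.isReach l then (M.enabled l).sup' (M.enabled_nonempty l) v
  else (M.enabled l).inf' (M.enabled_nonempty l) v

/-- `f` solves the Bellman equations on `[t−ε, t]` with terminal value `x`. -/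
def SolvesBellman (M : NCTMG L A) (t ε : ℝ) (x : L → ℝ) (f : L → ℝ → ℝ) : Prop :=
  (∀ l, f l t = x l) ∧
  ∀ l, ∀ τ ∈ Set.Icc (t - ε) t,
    HasDerivAt (f l) (-(M.opt l (fun a => ∑ l', M.Q l a l' * f l' τ))) τ

/-- `p1` is a single `ε`-net approximation from terminal value `x` with chosen
actions `act`: each `act l` is enabled and attains `opt_l` of `∑ Q(l,a,·)·x`,
and `p1(l, t−τ) = x(l) + τ·c_l` on `[0,ε]` where `c_l = ∑ Q(l,act l,·)·x`. -/
def IsSingleNet (M : NCTMG L A) (t ε : ℝ) (x : L → ℝ) (act : L → A)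
    (p1 : L → ℝ → ℝ) : Prop :=
  (∀ l, act l ∈ M.enabled l) ∧
  (∀ l, (∑ l', M.Q l (act l) l' * x l') =
      M.opt l (fun a => ∑ l', M.Q l a l' * x l')) ∧
  (∀ l, ∀ τ ∈ Set.Icc (0 : ℝ) ε,
      p1 l (t - τ) = x l + τ * (∑ l', M.Q l (act l) l' * x l'))

end NCTMG

/-- The sup-norm `‖v‖ = max_{l∈L} |v l|` on functions `L → ℝ`. -/
noncomputable def supNorm {L : Type} [Fintype L] [Nonempty L] (v : L → ℝ) : ℝ :=
  Finset.univ.sup' Finset.univ_nonempty (fun l => |v l|)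


theorem abs_le_supNorm {L : Type} [Fintype L] [Nonempty L] (v : L → ℝ) (l : L) :
    |v l| ≤ supNorm v :=
  Finset.le_sup' (fun l => |v l|) (Finset.mem_univ l)

theorem supNorm_le {L : Type} [Fintype L] [Nonempty L] {v : L → ℝ} {C : ℝ}
    (h : ∀ l, |v l| ≤ C) : supNorm v ≤ C :=
  Finset.sup'_le _ _ fun l _ => h l

namespace NCTMG

variable {L A : Type} [Fintype L] [DecidableEq L] [Fintype A]

theorem opt_le_opt_add (M : NCTMG L A) (l : L) {u v : A → ℝ} {D : ℝ}
    (h : ∀ a ∈ M.enabled l, u a ≤ v a + D) : M.opt l u ≤ M.opt l v + D := by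
  unfold opt
  split_ifs
  · refine Finset.sup'_le _ _ fun a ha => (h a ha).trans ?_
    gcongr
    exact Finset.le_sup' v ha
  · rw [← sub_le_iff_le_add]
    refine Finset.le_inf' _ _ fun a ha => ?_
    rw [sub_le_iff_le_add]
    exact (Finset.inf'_le u ha).trans (h a ha)

/-- `opt_l` is nonexpansive for the sup-norm over enabled actions. -/
theorem abs_opt_sub_opt_le (M : NCTMG L A) (l : L) {u v : A → ℝ} {D : ℝ}
    (h : ∀ a ∈ M.enabled l, |u a - v a| ≤ D) : |M.opt l u - M.opt l v| ≤ D := by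
  rw [abs_sub_le_iff]
  constructor
  · have := M.opt_le_opt_add l (u := u) (v := v) (D := D)
      fun a ha => by linarith [(abs_sub_le_iff.1 (h a ha)).1]
    linarith
  · have := M.opt_le_opt_add l (u := v) (v := u) (D := D)
      fun a ha => by linarith [(abs_sub_le_iff.1 (h a ha)).2]
    linarith

theorem sum_Q_mul (M : NCTMG L A) {l : L} {a : A} (ha : a ∈ M.enabled l) (y : L → ℝ) :
    ∑ l', M.Q l a l' * y l' = ∑ l', M.R l a l' * (y l' - y l) := by
  simp [Q, sub_mul, mul_sub, Finset.sum_sub_distrib, ← Finset.sum_mul, M.R_sum l a ha]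

/-- The generator has norm at most `2` on rows of enabled actions. -/
theorem abs_sum_R_mul_sub_le (M : NCTMG L A) {l : L} {a : A} (ha : a ∈ M.enabled l)
    {d : L → ℝ} {C : ℝ} (hd : ∀ l', |d l'| ≤ C) :
    |∑ l', M.R l a l' * (d l' - d l)| ≤ 2 * C := by
  calc |∑ l', M.R l a l' * (d l' - d l)|
      ≤ ∑ l', |M.R l a l' * (d l' - d l)| := Finset.abs_sum_le_sum_abs _ _
    _ ≤ ∑ l', M.R l a l' * (2 * C) := by
        refine Finset.sum_le_sum fun l' _ => ?_
        rw [abs_mul, abs_of_nonneg (M.R_nonneg l a l' ha)]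
        refine mul_le_mul_of_nonneg_left ?_ (M.R_nonneg l a l' ha)
        linarith [abs_sub (d l') (d l), hd l', hd l]
    _ = 2 * C := by rw [← Finset.sum_mul, M.R_sum l a ha, one_mul]

/-- The Bellman right-hand side is `2`-Lipschitz for the sup-norm. -/
theorem abs_opt_sum_R_sub_opt_sum_Q_le (M : NCTMG L A) (l : L) {y z : L → ℝ} {C : ℝ}
    (h : ∀ l', |y l' - z l'| ≤ C) :
    |M.opt l (fun a => ∑ l', M.R l a l' * (y l' - y l)) -
      M.opt l (fun a => ∑ l', M.Q l a l' * z l')| ≤ 2 * C := by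
  refine M.abs_opt_sub_opt_le l fun a ha => ?_
  rw [M.sum_Q_mul ha, ← Finset.sum_sub_distrib]
  convert M.abs_sum_R_mul_sub_le ha h using 3
  ring

end NCTMG

/-- if an approximation `q` deviates from the Bellman solution
`f` by at most `c·τ^(k+1)` after `τ` time units, then the next-level ε-net
approximation `p`, obtained by integrating the Bellman right-hand side with `q`
substituted for `f`, deviates by at most `(2c/(k+2))·τ^(k+2)`. -/
theorem net_level_bump {L A : Type} [Fintype L] [DecidableEq L] [Nonempty L]
    [Fintype A] (M : NCTMG L A) (t ε : ℝ) (hε : 0 < ε)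
    (k : ℕ) (hk : 1 ≤ k) (c : ℝ) (hc : 0 ≤ c)
    (x : L → ℝ) (f : L → ℝ → ℝ) (hf : M.SolvesBellman t ε x f)
    (q : L → ℝ → ℝ)
    (hq : ∀ τ ∈ Set.Icc (0 : ℝ) ε,
      supNorm (fun l => q l (t - τ) - f l (t - τ)) ≤ c * τ ^ (k + 1))
    (p : L → ℝ → ℝ)
    (hpt : ∀ l, p l t = f l t)
    (hp : ∀ l, ∀ τ ∈ Set.Icc (t - ε) t,
      HasDerivAt (p l)
        (-(M.opt l (fun a => ∑ l', M.R l a l' * (q l' τ - q l τ)))) τ) :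
    ∀ τ ∈ Set.Icc (0 : ℝ) ε,
      supNorm (fun l => p l (t - τ) - f l (t - τ)) ≤
        (2 * c / (k + 2)) * τ ^ (k + 2) := by
  intro τ hτ
  refine supNorm_le fun l => ?_
  have mem : ∀ s ∈ Set.Icc (0 : ℝ) ε, t - s ∈ Set.Icc (t - ε) t := fun s hs =>
    ⟨by linarith [hs.2], by linarith [hs.1]⟩
  have hderiv := fun s hs =>
    ((hp l (t - s) (mem s hs)).comp_const_sub t s).sub
      ((hf.2 l (t - s) (mem s hs)).comp_const_sub t s)
  have hB : ∀ s : ℝ, HasDerivAt (fun s : ℝ => 2 * c / (k + 2) * s ^ (k + 2))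
      (2 * (c * s ^ (k + 1))) s := fun s => by
    have hk2 : (k : ℝ) + 2 ≠ 0 := by positivity
    refine ((hasDerivAt_pow (k + 2) s).const_mul (2 * c / ((k : ℝ) + 2))).congr_deriv ?_
    rw [show k + 2 - 1 = k + 1 from rfl]
    push_cast
    field_simp
  refine image_norm_le_of_norm_deriv_right_le_deriv_boundary
    (f := fun s => p l (t - s) - f l (t - s))
    (fun s hs => (hderiv s hs).continuousAt.continuousWithinAt)
    (fun s hs => (hderiv s (Set.Ico_subset_Icc_self hs)).hasDerivWithinAt)
    (by simp [hpt l]) hB (fun s hs => ?_) hτ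
  rw [neg_neg, neg_neg, Real.norm_eq_abs]
  exact M.abs_opt_sum_R_sub_opt_sum_Q_le l fun l' =>
    (abs_le_supNorm (fun l => q l (t - s) - f l (t - s)) l').trans
      (hq s (Set.Ico_subset_Icc_self hs))
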